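/- Kuhn–Tucker condition for log-optimality: let U be a random vector taking values in 𝒰, and suppose b* ∈ Δ maximizes b ↦ E(log⟨b, U⟩) over Δ (expectations valued in [−∞, log m]) with E(log⟨b*, U⟩) > −∞. Then for every portfolio b ∈ Δ, E(⟨b, U⟩ / ⟨b*, U⟩) ≤ 1. (Content of the paper's Lemma 2(a) in unconditional form, cited from Bell–Cover/Algoet.) -/

import Mathlib

open MeasureTheory Filter
open scoped BigOperators ENNReal Topology

/-- Inner product of two vectors in `ℝ^m`. -/
noncomputable def ip {m : ℕ} (b x : Fin m → ℝ) : ℝ := ∑ i, b i * x i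

/-- The closed portfolio simplex. -/
def simplex (m : ℕ) : Set (Fin m → ℝ) := {b | (∀ i, 0 ≤ b i) ∧ ∑ i, b i = 1}

/-- The uniform reference portfolio `b̂ = (1/m, …, 1/m)`. -/
noncomputable def bhat (m : ℕ) : Fin m → ℝ := fun _ => (m : ℝ)⁻¹

/-- The set `𝒰` of normalized return vectors. -/
def Uset (m : ℕ) : Set (Fin m → ℝ) := {u | (∀ i, 0 < u i) ∧ ip (bhat m) u = 1}

/-- `nlog m r` is the nonnegative extended-real value `log m − log r`, set to `∞` for `r ≤ 0`. -/
noncomputable def nlog (m : ℕ) (r : ℝ) : ℝ≥0∞ :=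
  if r ≤ 0 then ⊤ else ENNReal.ofReal (Real.log m - Real.log r)

/-- The expectation `E(log⟨b, U⟩) ∈ [−∞, log m]` for `U ∼ Q` supported on `𝒰`. -/
noncomputable def elogQ {m : ℕ} (Q : Measure (Fin m → ℝ)) (b : Fin m → ℝ) : EReal :=
  (Real.log m : EReal) - ((∫⁻ u, nlog m (ip b u) ∂Q : ℝ≥0∞) : EReal)

lemma ip_pos {m : ℕ} {b u : Fin m → ℝ} (hb : b ∈ simplex m) (hu : u ∈ Uset m) : 0 < ip b u := by
  obtain ⟨i, -, hi⟩ : ∃ i ∈ Finset.univ, 0 < b i := by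
    by_contra! h
    have := Finset.sum_nonpos h
    linarith [hb.2]
  exact Finset.sum_pos' (fun j _ => mul_nonneg (hb.1 j) (hu.1 j).le)
    ⟨i, Finset.mem_univ i, mul_pos hi (hu.1 i)⟩

lemma ip_le {m : ℕ} {b u : Fin m → ℝ} (hb : b ∈ simplex m) (hu : u ∈ Uset m) : ip b u ≤ m := by
  have hsum : ∑ i, u i ≤ m := by
    have h := hu.2
    simp only [ip, bhat, ← Finset.mul_sum] at h
    rcases Nat.eq_zero_or_pos m with rfl | hm
    · simp
    · have : (0 : ℝ) < m := by exact_mod_cast hm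
      field_simp at h
      exact h.le
  refine le_trans (Finset.sum_le_sum fun i _ => ?_) hsum
  have hbi : b i ≤ 1 := hb.2 ▸ Finset.single_le_sum (fun j _ => hb.1 j) (Finset.mem_univ i)
  exact mul_le_of_le_one_left (hu.1 i).le hbi

lemma measurable_ip {m : ℕ} (b : Fin m → ℝ) : Measurable (ip b) := by
  unfold ip
  fun_prop

lemma measurable_nlog (m : ℕ) : Measurable (nlog m) := by
  unfold nlog
  exact Measurable.ite measurableSet_Iic measurable_const (by fun_prop)

lemma ip_smul_add {m : ℕ} (s t : ℝ) (a b u : Fin m → ℝ) :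
    ip (s • (a + t • b)) u = s * (ip a u + t * ip b u) := by
  simp only [ip, Pi.smul_apply, Pi.add_apply, smul_eq_mul, Finset.mul_sum, ← Finset.sum_add_distrib]
  exact Finset.sum_congr rfl fun i _ => by ring

lemma smul_add_mem_simplex {m : ℕ} {a b : Fin m → ℝ} (ha : a ∈ simplex m) (hb : b ∈ simplex m)
    {t : ℝ} (ht : 0 ≤ t) : (1 + t)⁻¹ • (a + t • b) ∈ simplex m := by
  refine ⟨fun i => ?_, ?_⟩
  · have := ha.1 i
    have := hb.1 i
    simp only [Pi.smul_apply, Pi.add_apply, smul_eq_mul]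
    positivity
  · simp only [Pi.smul_apply, Pi.add_apply, smul_eq_mul, ← Finset.mul_sum, Finset.sum_add_distrib,
      ha.2, hb.2, mul_one]
    exact inv_mul_cancel₀ (by positivity)

/-- Moving from `a` towards `b` changes the logarithmic loss by `log (1 + t) - log (1 + t * R)`,
where `R` is the ratio of the two returns. -/
lemma nlog_smul_add {m : ℕ} {a b u : Fin m → ℝ} (ha : a ∈ simplex m) (hb : b ∈ simplex m)
    (hu : u ∈ Uset m) {t : ℝ} (ht : 0 ≤ t) :
    nlog m (ip ((1 + t)⁻¹ • (a + t • b)) u)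
        + ENNReal.ofReal (Real.log (1 + t * (ip b u / ip a u)))
      = nlog m (ip a u) + ENNReal.ofReal (Real.log (1 + t)) := by
  have hc := smul_add_mem_simplex ha hb ht
  have hcpos := ip_pos hc hu
  have hapos := ip_pos ha hu
  have hbpos := ip_pos hb hu
  have hR : 0 ≤ t * (ip b u / ip a u) := by positivity
  have hprod : ip ((1 + t)⁻¹ • (a + t • b)) u * (1 + t)
      = ip a u * (1 + t * (ip b u / ip a u)) := by
    rw [ip_smul_add]
    field_simp
  have hlog := congrArg Real.log hprod
  rw [Real.log_mul hcpos.ne' (by positivity), Real.log_mul hapos.ne' (by positivity)] at hlog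
  rw [nlog, nlog, if_neg hcpos.not_ge, if_neg hapos.not_ge,
    ← ENNReal.ofReal_add (sub_nonneg.2 (Real.log_le_log hcpos (ip_le hc hu)))
      (Real.log_nonneg (by linarith)),
    ← ENNReal.ofReal_add (sub_nonneg.2 (Real.log_le_log hapos (ip_le ha hu)))
      (Real.log_nonneg (by linarith))]
  congr 1
  linarith

lemma lintegral_nlog_le_of_elogQ_le {m : ℕ} {Q : Measure (Fin m → ℝ)} {a b : Fin m → ℝ}
    (h : elogQ Q b ≤ elogQ Q a) :
    ∫⁻ u, nlog m (ip a u) ∂Q ≤ ∫⁻ u, nlog m (ip b u) ∂Q := by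
  unfold elogQ at h
  by_contra! hlt
  have hneg := EReal.neg_lt_neg_iff.2 (EReal.coe_ennreal_lt_coe_ennreal_iff.2 hlt)
  exact h.not_gt (EReal.add_lt_add_left_coe hneg (Real.log m))

lemma lintegral_nlog_ne_top_of_bot_lt {m : ℕ} {Q : Measure (Fin m → ℝ)} {a : Fin m → ℝ}
    (h : ⊥ < elogQ Q a) : ∫⁻ u, nlog m (ip a u) ∂Q ≠ ⊤ := by
  intro htop
  rw [elogQ, htop] at h
  simp at h

/-- If `a` is log-optimal, the expected logarithmic gain along the segment towards `b` is at most
`log (1 + t)`. -/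
lemma lintegral_log_one_add_le {Ω : Type*} [MeasurableSpace Ω] {P : Measure Ω}
    [IsProbabilityMeasure P] {m : ℕ} {U : Ω → (Fin m → ℝ)} (hUmeas : Measurable U)
    (hU : ∀ ω, U ω ∈ Uset m) {a b : Fin m → ℝ} (ha : a ∈ simplex m) (hb : b ∈ simplex m)
    (hmax : ∀ c ∈ simplex m, elogQ (P.map U) c ≤ elogQ (P.map U) a)
    (hfin : (⊥ : EReal) < elogQ (P.map U) a) {t : ℝ} (ht : 0 ≤ t) :
    ∫⁻ ω, ENNReal.ofReal (Real.log (1 + t * (ip b (U ω) / ip a (U ω)))) ∂P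
      ≤ ENNReal.ofReal (Real.log (1 + t)) := by
  have hmeas (c : Fin m → ℝ) : Measurable fun u => nlog m (ip c u) :=
    (measurable_nlog m).comp (measurable_ip c)
  have hle := lintegral_nlog_le_of_elogQ_le (hmax _ (smul_add_mem_simplex ha hb ht))
  have hne := lintegral_nlog_ne_top_of_bot_lt hfin
  rw [lintegral_map (hmeas _) hUmeas] at hne
  rw [lintegral_map (hmeas _) hUmeas, lintegral_map (hmeas _) hUmeas] at hle
  have hmeasU (c : Fin m → ℝ) : Measurable fun ω => nlog m (ip c (U ω)) := (hmeas c).comp hUmeas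
  have hsum := lintegral_congr (μ := P) fun ω => nlog_smul_add ha hb (hU ω) ht
  rw [lintegral_add_left (hmeasU _), lintegral_add_left (hmeasU _),
    lintegral_const, measure_univ, mul_one] at hsum
  refine (ENNReal.add_le_add_iff_left hne).1 ?_
  rw [← hsum]
  gcongr

/-- Kuhn–Tucker condition for log-optimality (Lemma 2(a), unconditional form):
if `b*` maximizes `b ↦ E(log⟨b, U⟩)` over the simplex with finite optimal value,
then `E(⟨b, U⟩/⟨b*, U⟩) ≤ 1` for every portfolio `b`. -/
theorem stmt_2 {Ω : Type*} [MeasurableSpace Ω] (P : Measure Ω) [IsProbabilityMeasure P]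
    (m : ℕ) (hm : 2 ≤ m)
    (U : Ω → (Fin m → ℝ)) (hUmeas : Measurable U) (hU : ∀ ω, U ω ∈ Uset m)
    (bstar : Fin m → ℝ) (hbstar : bstar ∈ simplex m)
    (hmax : ∀ b ∈ simplex m, elogQ (P.map U) b ≤ elogQ (P.map U) bstar)
    (hfin : (⊥ : EReal) < elogQ (P.map U) bstar) :
    ∀ b ∈ simplex m,
      ∫⁻ ω, ENNReal.ofReal (ip b (U ω) / ip bstar (U ω)) ∂P ≤ 1 := by
  intro b hb
  have hlim (ω : Ω) : Tendsto (fun n : ℕ => ENNReal.ofReal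
      (n * Real.log (1 + (n : ℝ)⁻¹ * (ip b (U ω) / ip bstar (U ω))))) atTop
      (𝓝 (ENNReal.ofReal (ip b (U ω) / ip bstar (U ω)))) := by
    refine ENNReal.tendsto_ofReal ?_
    simpa only [Function.comp_def, inv_mul_eq_div] using
      (Real.tendsto_mul_log_one_add_div_atTop (ip b (U ω) / ip bstar (U ω))).comp
        tendsto_natCast_atTop_atTop
  have hbound (n : ℕ) : ∫⁻ ω, ENNReal.ofReal
      (n * Real.log (1 + (n : ℝ)⁻¹ * (ip b (U ω) / ip bstar (U ω)))) ∂P ≤ 1 := by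
    have ht : (0 : ℝ) ≤ (n : ℝ)⁻¹ := by positivity
    simp_rw [ENNReal.ofReal_mul (Nat.cast_nonneg (α := ℝ) n)]
    rw [lintegral_const_mul' _ _ ENNReal.ofReal_ne_top]
    refine (mul_le_mul_right
      (lintegral_log_one_add_le hUmeas hU hbstar hb hmax hfin ht) _).trans ?_
    rw [← ENNReal.ofReal_mul n.cast_nonneg, ENNReal.ofReal_le_one]
    calc (n : ℝ) * Real.log (1 + (n : ℝ)⁻¹) ≤ n * (n : ℝ)⁻¹ := by
          gcongr
          linarith [Real.log_le_sub_one_of_pos (show 0 < 1 + (n : ℝ)⁻¹ by positivity)]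
      _ ≤ 1 := mul_inv_le_one
  have hmeas (n : ℕ) : Measurable fun ω => ENNReal.ofReal
      (n * Real.log (1 + (n : ℝ)⁻¹ * (ip b (U ω) / ip bstar (U ω)))) := by
    have h₁ := (measurable_ip b).comp hUmeas
    have h₂ := (measurable_ip bstar).comp hUmeas
    exact (((h₁.div h₂).const_mul _).const_add _).log.const_mul _ |>.ennreal_ofReal
  calc ∫⁻ ω, ENNReal.ofReal (ip b (U ω) / ip bstar (U ω)) ∂P
      = ∫⁻ ω, liminf (fun n : ℕ => ENNReal.ofReal
          (n * Real.log (1 + (n : ℝ)⁻¹ * (ip b (U ω) / ip bstar (U ω))))) atTop ∂P :=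
        lintegral_congr fun ω => (hlim ω).liminf_eq.symm
    _ ≤ liminf (fun n : ℕ => ∫⁻ ω, ENNReal.ofReal
          (n * Real.log (1 + (n : ℝ)⁻¹ * (ip b (U ω) / ip bstar (U ω)))) ∂P) atTop :=
        lintegral_liminf_le hmeas
    _ ≤ liminf (fun _ : ℕ => (1 : ℝ≥0∞)) atTop := liminf_le_liminf (.of_forall hbound)
    _ = 1 := liminf_const 1
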